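/- Let (x, y, h) be an sl2-triple of N×N complex matrices. If z is an N×N complex matrix such that z = g x g⁻¹ for some g ∈ GL_N(ℂ) and z − x lies in the kernel of ad y (i.e. z lies in the Slodowy slice x + Ker(ad y)), then z = x. In other words, the Slodowy slice at x meets the conjugation orbit of x only in the point x. -/

import Mathlib

/-- The adjoint action `ad z : v ↦ z*v - v*z` on N×N complex matrices, as a linear map. -/
noncomputable def ad (N : ℕ) (z : Matrix (Fin N) (Fin N) ℂ) :
    Matrix (Fin N) (Fin N) ℂ →ₗ[ℂ] Matrix (Fin N) (Fin N) ℂ :=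
  LinearMap.mulLeft ℂ z - LinearMap.mulRight ℂ z

section Sl2

variable {V : Type*} [AddCommGroup V] [Module ℂ V] {X Y H L : Module.End ℂ V}

theorem sl2_pow_succ_mul (h1 : X * Y - Y * X = H) (h3 : H * Y - Y * H = (-2 : ℂ) • Y) (n : ℕ) :
    Y ^ (n + 1) * X = X * Y ^ (n + 1) - ((n : ℂ) + 1) • (H * Y ^ n + (n : ℂ) • Y ^ n) := by
  have hYX : Y * X = X * Y - H := by rw [← h1]; abel
  have hYH : Y * H = H * Y + (2 : ℂ) • Y := by
    rw [sub_eq_iff_eq_add] at h3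
    rw [h3]; module
  induction n with
  | zero => simp [hYX]
  | succ n ih =>
    have e : Y ^ (n + 1) = Y * Y ^ n := pow_succ' Y n
    rw [pow_succ' Y (n + 1), mul_assoc, ih, mul_sub, ← mul_assoc, hYX, mul_smul_comm, mul_add,
      ← mul_assoc Y H, hYH, mul_smul_comm, ← e, add_mul, sub_mul, smul_mul_assoc, mul_assoc H,
      ← e, mul_assoc X]
    push_cast
    module

theorem sl2_isNilpotent [FiniteDimensional ℂ V] (h3 : H * Y - Y * H = (-2 : ℂ) • Y) :
    IsNilpotent Y := by
  have hpow (n : ℕ) : H * Y ^ n - Y ^ n * H = (-2 * n : ℂ) • Y ^ n := by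
    induction n with
    | zero => simp
    | succ n ih =>
      have : H * Y ^ (n + 1) - Y ^ (n + 1) * H =
          (H * Y ^ n - Y ^ n * H) * Y + Y ^ n * (H * Y - Y * H) := by
        rw [pow_succ]; noncomm_ring
      rw [this, ih, h3, smul_mul_assoc, mul_smul_comm, ← pow_succ, ← add_smul]
      push_cast
      ring_nf
  by_contra hY
  let A : Module.End ℂ (Module.End ℂ V) := LinearMap.mulLeft ℂ H - LinearMap.mulRight ℂ H
  have hev (n : ℕ) : A.HasEigenvalue (-2 * n : ℂ) :=
    Module.End.hasEigenvalue_of_hasEigenvector (x := Y ^ n)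
      ⟨Module.End.mem_eigenspace_iff.2 (by simpa [A] using hpow n), fun h0 => hY ⟨n, h0⟩⟩
  refine Set.infinite_of_injective_forall_mem (f := fun n : ℕ => (-2 * n : ℂ)) ?_ hev
    (Module.End.finite_hasEigenvalue A)
  intro a b hab
  simpa using hab

/-- If `L` commutes with `Y`, then `Y * (X + L)` is injective on the range of `Y`. -/
theorem sl2_eq_zero_of_mem_range [FiniteDimensional ℂ V] (h1 : X * Y - Y * X = H)
    (h3 : H * Y - Y * H = (-2 : ℂ) • Y) (hL : Commute L Y) (u : V)
    (hw : Y ((X + L) (Y u)) = 0) : Y u = 0 := by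
  have key (n : ℕ) (a : V) : (Y ^ (n + 1)) (X a) =
      X ((Y ^ (n + 1)) a) - ((n : ℂ) + 1) • (H ((Y ^ n) a) + (n : ℂ) • (Y ^ n) a) := by
    simpa using LinearMap.congr_fun (sl2_pow_succ_mul h1 h3 n) a
  obtain ⟨k, hk⟩ := sl2_isNilpotent h3
  have step (n : ℕ) (hn : (Y ^ (n + 1)) (Y u) = 0) : (Y ^ n) (Y u) = 0 := by
    set p := (Y ^ n) (Y u) with hp
    have hYp : Y p = 0 := by rw [hp, ← hn, pow_succ', Module.End.mul_apply]
    have hX : (Y ^ (n + 1)) (X (Y u)) = 0 := by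
      have hc : (Y ^ (n + 1)) (L (Y u)) = 0 := by
        rw [← Module.End.mul_apply, ← (hL.pow_right (n + 1)).eq, Module.End.mul_apply, hn, map_zero]
      have : (Y ^ (n + 1)) ((X + L) (Y u)) = 0 := by
        rw [pow_succ, Module.End.mul_apply, hw, map_zero]
      rwa [LinearMap.add_apply, map_add, hc, add_zero] at this
    have hH : H p = -(n : ℂ) • p := by
      have := key n (Y u)
      rw [hX, hn, map_zero, zero_sub, zero_eq_neg, smul_eq_zero] at this
      rw [neg_smul]
      exact eq_neg_of_add_eq_zero_left (this.resolve_left (Nat.cast_add_one_ne_zero n))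
    have hmem (j : ℕ) : ∃ a, (Y ^ (n + 1 + j)) a = p := by
      induction j with
      | zero => exact ⟨u, by rw [hp, add_zero, pow_succ, Module.End.mul_apply]⟩
      | succ j ih =>
        obtain ⟨a, ha⟩ := ih
        have hkey := key (n + 1 + j) a
        rw [pow_succ' Y (n + 1 + j), Module.End.mul_apply, Module.End.mul_apply, ha, hYp,
          map_zero, hH, ← Module.End.mul_apply, ← pow_succ'] at hkey
        have hc : ((n : ℂ) + j + 2) * (j + 1) ≠ 0 := by
          refine mul_ne_zero ?_ (Nat.cast_add_one_ne_zero j)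
          exact_mod_cast (by omega : n + j + 2 ≠ 0)
        refine ⟨(-(((n : ℂ) + j + 2) * (j + 1))⁻¹) • X a, ?_⟩
        have hsum : (Y ^ (n + 1 + j + 1)) (X a) = (-(((n : ℂ) + j + 2) * (j + 1))) • p := by
          rw [hkey]
          push_cast
          module
        rw [map_smul, ← add_assoc, hsum, smul_smul, neg_mul_neg, inv_mul_cancel₀ hc, one_smul]
    obtain ⟨a, ha⟩ := hmem k
    rw [← ha, pow_add, hk, mul_zero, LinearMap.zero_apply]
  have descend (n : ℕ) (hn : (Y ^ n) (Y u) = 0) : Y u = 0 := by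
    induction n with
    | zero => simpa using hn
    | succ n ih => exact ih (step n hn)
  exact descend k (by rw [hk, LinearMap.zero_apply])

theorem sl2_finrank_range_le [FiniteDimensional ℂ V] (h1 : X * Y - Y * X = H)
    (h3 : H * Y - Y * H = (-2 : ℂ) • Y) (hL : Commute L Y) :
    Module.finrank ℂ (LinearMap.range Y) ≤ Module.finrank ℂ (LinearMap.range (Y * (X + L))) := by
  let f : LinearMap.range Y →ₗ[ℂ] LinearMap.range (Y * (X + L)) :=
    (Y * (X + L)).rangeRestrict.comp (LinearMap.range Y).subtype
  refine LinearMap.finrank_le_finrank_of_injective (f := f) ?_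
  rw [← LinearMap.ker_eq_bot, LinearMap.ker_eq_bot']
  rintro ⟨_, u, rfl⟩ hu
  exact Subtype.ext (sl2_eq_zero_of_mem_range h1 h3 hL u (congrArg Subtype.val hu))

end Sl2

theorem ad_mul_sub (N : ℕ) (a b : Matrix (Fin N) (Fin N) ℂ) :
    (ad N a * ad N b - ad N b * ad N a : Module.End ℂ _) = ad N (a * b - b * a) := by
  ext1 m
  simp only [ad, LinearMap.sub_apply, Module.End.mul_apply, LinearMap.mulLeft_apply,
    LinearMap.mulRight_apply]
  noncomm_ring

theorem ad_smul (N : ℕ) (c : ℂ) (a : Matrix (Fin N) (Fin N) ℂ) : ad N (c • a) = c • ad N a := by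
  ext1 m
  simp [ad, smul_sub]

/-- for an sl2-triple (x,y,h), the Slodowy slice `x + Ker(ad y)` meets the
conjugation orbit of `x` only in `x` itself: if `z = g x g⁻¹` for some `g ∈ GL_N(ℂ)`
and `z - x ∈ Ker(ad y)`, then `z = x`. -/
theorem stmt2 (N : ℕ) (x y h : Matrix (Fin N) (Fin N) ℂ)
    (h1 : x * y - y * x = h)
    (h2 : h * x - x * h = (2 : ℂ) • x)
    (h3 : h * y - y * h = (-2 : ℂ) • y)
    (z : Matrix (Fin N) (Fin N) ℂ)
    (hz : ∃ g : (Matrix (Fin N) (Fin N) ℂ)ˣ, z = g.val * x * (g⁻¹).val)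
    (hslice : z - x ∈ LinearMap.ker (ad N y)) :
    z = x := by
  obtain ⟨g, hg⟩ := hz
  let X : Module.End ℂ (Matrix (Fin N) (Fin N) ℂ) := ad N x
  let Y : Module.End ℂ (Matrix (Fin N) (Fin N) ℂ) := ad N y
  let L : Module.End ℂ (Matrix (Fin N) (Fin N) ℂ) := LinearMap.mulLeft ℂ (z - x)
  have hXY : X * Y - Y * X = ad N h := by rw [← h1]; exact ad_mul_sub N x y
  have hHX : ad N h * X - X * ad N h = (2 : ℂ) • X := by
    rw [← ad_smul, ← h2]; exact ad_mul_sub N h x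
  have hHY : ad N h * Y - Y * ad N h = (-2 : ℂ) • Y := by
    rw [← ad_smul, ← h3]; exact ad_mul_sub N h y
  have hv : y * (z - x) = (z - x) * y := by
    simpa [ad, sub_eq_zero] using hslice
  have hL : Commute L Y := by
    refine LinearMap.ext fun m => ?_
    simp only [L, Y, ad, LinearMap.sub_apply, Module.End.mul_apply, LinearMap.mulLeft_apply,
      LinearMap.mulRight_apply]
    rw [mul_sub, ← mul_assoc, ← hv]
    simp only [mul_assoc]
  have hT (m : Matrix (Fin N) (Fin N) ℂ) : (X + L) m = z * m - m * x := by
    simp only [X, L, ad, LinearMap.add_apply, LinearMap.sub_apply, LinearMap.mulLeft_apply,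
      LinearMap.mulRight_apply]
    noncomm_ring
  have hker : Module.finrank ℂ (LinearMap.ker X) ≤ Module.finrank ℂ (LinearMap.ker (X + L)) := by
    let f : LinearMap.ker X →ₗ[ℂ] LinearMap.ker (X + L) :=
      LinearMap.restrict (LinearMap.mulLeft ℂ g.val) fun m hm => by
        have hm' : x * m = m * x := by simpa [X, ad, sub_eq_zero] using hm
        rw [LinearMap.mem_ker, hT, hg, LinearMap.mulLeft_apply, sub_eq_zero, mul_assoc, mul_assoc,
          Units.inv_mul_cancel_left, mul_assoc, hm']
    refine LinearMap.finrank_le_finrank_of_injective (f := f) fun a b hab => Subtype.ext ?_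
    exact g.isUnit.mul_left_cancel (congrArg Subtype.val hab)
  have hY := sl2_finrank_range_le hXY hHY hL
  have hX : Module.finrank ℂ (LinearMap.range X) ≤ Module.finrank ℂ (LinearMap.range Y) := by
    have hle := sl2_finrank_range_le (X := Y) (Y := X) (H := -ad N h) (L := 0)
      (by rw [← hXY, neg_sub]) (by rw [neg_smul (2 : ℂ) X, ← hHX, neg_mul (ad N h : Module.End ℂ _) X,
        mul_neg X (ad N h : Module.End ℂ _)]; abel) (Commute.zero_left X)
    rw [add_zero] at hle
    have e : X * Y = X.comp Y := rfl
    rw [e, LinearMap.range_comp] at hle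
    exact hle.trans (Submodule.finrank_map_le X (LinearMap.range Y))
  have r1 := X.finrank_range_add_finrank_ker
  have r2 := (Y * (X + L)).finrank_range_add_finrank_ker
  have heq : LinearMap.ker (X + L) = LinearMap.ker (Y * (X + L)) :=
    Submodule.eq_of_le_of_finrank_le (LinearMap.ker_le_ker_comp (X + L) Y) (by omega)
  have hone : (1 : Matrix (Fin N) (Fin N) ℂ) ∈ LinearMap.ker (X + L) := by
    rw [heq, LinearMap.mem_ker, Module.End.mul_apply, hT, mul_one, one_mul]
    exact hslice
  rwa [LinearMap.mem_ker, hT, mul_one, one_mul, sub_eq_zero] at hone
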